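/- The third group cohomology of the alternating group with trivial integer coefficients satisfies H^3(𝔄_6, ℤ_triv) ≅ ℤ/6ℤ and H^3(𝔄_7, ℤ_triv) ≅ ℤ/6ℤ. -/

import Mathlib

open CategoryTheory

noncomputable section

/-- The alternating group `𝔄ₙ` on `{1, …, n}`. -/
abbrev Alt (n : ℕ) : Type := alternatingGroup (Fin n)


abbrev QZ : Type := AddCircle (1 : ℚ)

def avgIn (G : Type) [Group G] [Finite G] :
    Rep.trivial ℤ G ℚ ⟶ Rep.coind (⊥ : Subgroup G).subtype (Rep.trivial ℤ (⊥ : Subgroup G) ℚ) :=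
  Rep.ofHom (LinearMap.intertwiningMap_of_isIntertwiningMap _ _
    ({ toFun := fun q => ⟨fun _ => q, fun _ _ => rfl⟩
       map_add' := fun _ _ => rfl
       map_smul' := fun _ _ => rfl } : ℚ →ₗ[ℤ] _) (fun _ _ => rfl))

def avgOut (G : Type) [Group G] [Fintype G] :
    Rep.coind (⊥ : Subgroup G).subtype (Rep.trivial ℤ (⊥ : Subgroup G) ℚ) ⟶ Rep.trivial ℤ G ℚ :=
  Rep.ofHom (LinearMap.intertwiningMap_of_isIntertwiningMap _ _
    ({ toFun := fun f => (∑ g : G, f.1 g) / (Fintype.card G : ℚ)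
       map_add' := fun a b => by
        rw [← add_div, ← Finset.sum_add_distrib]; rfl
       map_smul' := fun n a => by
        simp only [zsmul_eq_mul, RingHom.id_apply, ← mul_div_assoc, Finset.mul_sum]
        congr 1 } : _ →ₗ[ℤ] ℚ) (fun g v => by
        change (∑ h : G, v.1 (h * g)) / (Fintype.card G : ℚ) = (∑ h : G, v.1 h) / (Fintype.card G : ℚ)
        congr 1
        exact Fintype.sum_equiv (Equiv.mulRight g) _ _ (fun _ => rfl)))

lemma avg_comp (G : Type) [Group G] [Fintype G] : avgIn G ≫ avgOut G = 𝟙 _ := by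
  apply Rep.hom_ext
  ext (q : ℚ)
  change (∑ h : G, q) / (Fintype.card G : ℚ) = q
  have : (Fintype.card G : ℚ) ≠ 0 := by exact_mod_cast Fintype.card_ne_zero
  simp

lemma isZero_Q (G : Type) [Group G] [Fintype G] (n : ℕ) :
    Limits.IsZero (groupCohomology (Rep.trivial ℤ G ℚ) (n + 1)) := by
  have h : Limits.IsZero (groupCohomology (Rep.coind (⊥ : Subgroup G).subtype
      (Rep.trivial ℤ (⊥ : Subgroup G) ℚ)) (n + 1)) :=
    (isZero_groupCohomology_succ_of_subsingleton _ n).of_iso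
      (groupCohomology.coindIso _ _)
  have : IsSplitMono (avgIn G) := ⟨⟨⟨avgOut G, avg_comp G⟩⟩⟩
  have : Mono ((groupCohomology.functor ℤ G (n + 1)).map (avgIn G)) :=
    (inferInstance : IsSplitMono ((groupCohomology.functor ℤ G (n + 1)).map (avgIn G))).mono
  exact @Limits.IsZero.of_mono _ _ _ _ _ ((groupCohomology.functor ℤ G (n + 1)).map (avgIn G)) this h

def trivMap (G : Type) [Group G] {V W : Type} [AddCommGroup V] [AddCommGroup W] (f : V →+ W) :
    Rep.trivial ℤ G V ⟶ Rep.trivial ℤ G W :=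
  Rep.ofHom (LinearMap.intertwiningMap_of_isIntertwiningMap _ _ f.toIntLinearMap (fun _ _ => rfl))

def seqX (G : Type) [Group G] : ShortComplex (Rep ℤ G) where
  X₁ := Rep.trivial ℤ G ℤ
  X₂ := Rep.trivial ℤ G ℚ
  X₃ := Rep.trivial ℤ G QZ
  f := trivMap G (Int.castAddHom ℚ)
  g := trivMap G (QuotientAddGroup.mk' _)
  zero := by
    apply Rep.hom_ext
    ext
    change (((1 : ℤ) : ℚ) : QZ) = 0
    simp

lemma rep_exact {k G : Type} [CommRing k] [Group G] (S : ShortComplex (Rep.{0} k G))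
    (h : ∀ x : S.X₂, S.g.hom x = 0 → ∃ y : S.X₁, S.f.hom y = x) : S.Exact :=
  (forget₂ (Rep.{0} k G) (ModuleCat k)).reflects_exact_of_faithful _ <|
    (ShortComplex.moduleCat_exact_iff _).2 h

lemma seqX_exact (G : Type) [Group G] : (seqX G).ShortExact where
  exact := rep_exact _ fun (x : ℚ) hx => by
      change ((x : ℚ) : QZ) = 0 at hx
      rw [AddCircle.coe_eq_zero_iff] at hx
      obtain ⟨n, hn⟩ := hx
      refine ⟨(n : ℤ), ?_⟩
      change (n : ℚ) = x
      simpa using hn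
  mono_f := (Rep.mono_iff_injective _).2 (fun a b h => Int.cast_injective (α := ℚ) h)
  epi_g := (Rep.epi_iff_surjective _).2 (fun x => QuotientAddGroup.mk_surjective x)

lemma H3equiv (G : Type) [Group G] [Fintype G] :
    Nonempty (groupCohomology (Rep.trivial ℤ G ℤ) 3 ≃+ groupCohomology.H2 (Rep.trivial ℤ G QZ)) := by
  have := groupCohomology.isIso_δ_of_isZero (seqX_exact G) 2 (isZero_Q G 1) (isZero_Q G 2)
  exact ⟨(asIso (groupCohomology.δ (seqX_exact G) 2 3 rfl)).symm.toLinearEquiv.toAddEquiv⟩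

open scoped commutatorElement

/-- trivial-action 2-cocycle identity -/
def IsCoc {G A : Type} [Group G] [AddCommGroup A] (f : G × G → A) : Prop :=
  ∀ g h k : G, f (g * h, k) + f (g, h) = f (h, k) + f (g, h * k)

lemma IsCoc.one_left {G A : Type} [Group G] [AddCommGroup A] {f : G × G → A} (hf : IsCoc f) (g : G) :
    f (1, g) = f (1, 1) := by
  have := hf 1 1 g
  simp only [one_mul] at this
  exact (add_left_cancel this).symm

lemma IsCoc.one_right {G A : Type} [Group G] [AddCommGroup A] {f : G × G → A} (hf : IsCoc f) (g : G) :
    f (g, 1) = f (1, 1) := by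
  have := hf g 1 1
  simp only [mul_one] at this
  exact add_right_cancel this

/-- the central extension defined by a cocycle -/
@[ext] structure CExt {G : Type} [Group G] (f : G × G → QZ) (hf : IsCoc f) where
  a : QZ
  g : G

namespace CExt

variable {G : Type} [Group G] {f : G × G → QZ} {hf : IsCoc f}

instance : Mul (CExt f hf) := ⟨fun u v => ⟨u.a + v.a + f (u.g, v.g), u.g * v.g⟩⟩
instance : One (CExt f hf) := ⟨⟨-f (1, 1), 1⟩⟩
instance : Inv (CExt f hf) := ⟨fun u => ⟨-u.a - f (u.g⁻¹, u.g) - f (1, 1), u.g⁻¹⟩⟩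

lemma mul_def (u v : CExt f hf) : u * v = ⟨u.a + v.a + f (u.g, v.g), u.g * v.g⟩ := rfl
lemma one_def : (1 : CExt f hf) = ⟨-f (1, 1), 1⟩ := rfl
lemma inv_def (u : CExt f hf) : u⁻¹ = ⟨-u.a - f (u.g⁻¹, u.g) - f (1, 1), u.g⁻¹⟩ := rfl

instance : Group (CExt f hf) := Group.ofLeftAxioms
  (fun u v w => by
    ext
    · have := hf u.g v.g w.g
      simp only [mul_def]
      calc _ = u.a + v.a + w.a + (f (u.g * v.g, w.g) + f (u.g, v.g)) := by abel
        _ = _ := by rw [this]; abel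
    · simp only [mul_def, mul_assoc])
  (fun u => by
    ext
    · simp only [mul_def, one_def]
      rw [hf.one_left u.g]; abel
    · simp [mul_def, one_def])
  (fun u => by
    ext
    · simp only [mul_def, one_def, inv_def]; abel
    · simp [mul_def, one_def, inv_def])

variable (hf) in
def proj : CExt f hf →* G where
  toFun := CExt.g
  map_one' := rfl
  map_mul' _ _ := rfl

variable (hf) in
def ι : Multiplicative QZ →* CExt f hf where
  toFun a := ⟨a.toAdd - f (1, 1), 1⟩
  map_one' := by ext <;> simp [one_def]
  map_mul' a b := by
    ext
    · simp only [mul_def, toAdd_mul]; abel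
    · simp [mul_def]

variable (hf) in
def lft (g : G) : CExt f hf := ⟨0, g⟩

lemma ι_inj : Function.Injective (ι hf) := by
  intro a b h
  have := congrArg CExt.a h
  exact sub_left_injective (G := QZ) (b := f (1, 1)) this

lemma ι_central (a : Multiplicative QZ) (u : CExt f hf) : Commute (ι hf a) u := by
  ext
  · simp only [mul_def, ι, MonoidHom.coe_mk, OneHom.coe_mk]
    rw [hf.one_left u.g, hf.one_right u.g]; abel
  · simp [mul_def, ι]

lemma exists_ι {u : CExt f hf} (h : proj hf u = 1) : ∃ a, ι hf a = u := by
  refine ⟨Multiplicative.ofAdd (u.a + f (1, 1)), ?_⟩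
  ext
  · simp [ι]
  · exact h.symm

lemma proj_ι (a) : proj hf (ι hf a) = 1 := rfl

lemma exists_ι' {u v : CExt f hf} (h : proj hf u = proj hf v) : ∃ a, u = ι hf a * v := by
  obtain ⟨a, ha⟩ := exists_ι (u := u * v⁻¹) (by simp [h])
  exact ⟨a, by simp [ha]⟩

lemma commute_of_proj {u v w : CExt f hf} (h : proj hf u = proj hf v) (hc : Commute v w) :
    Commute u w := by
  obtain ⟨a, rfl⟩ := exists_ι' h
  exact (ι_central a w).mul_left hc

lemma lft_comm (x y : G) (hxy : Commute x y) :
    lft hf x * lft hf y = ι hf (Multiplicative.ofAdd (f (x, y) - f (y, x))) * (lft hf y * lft hf x) := by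
  ext
  · simp only [mul_def, ι, lft, MonoidHom.coe_mk, OneHom.coe_mk, toAdd_ofAdd]
    rw [hf.one_left (y * x)]; abel
  · simp [mul_def, ι, lft, hxy.eq]

lemma lft_commute {x y : G} (hxy : Commute x y) (h : f (x, y) = f (y, x)) :
    Commute (lft hf x) (lft hf y) := by
  have := lft_comm (hf := hf) x y hxy
  rw [h, sub_self] at this
  rw [ofAdd_zero, map_one, one_mul] at this
  exact this

lemma pairing_torsion (hf : IsCoc f) {x y : G} (hxy : Commute x y) (n : ℕ) (hx : x ^ n = 1) :
    n • (f (x, y) - f (y, x)) = 0 := by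
  set p := Multiplicative.ofAdd (f (x, y) - f (y, x)) with hp
  have key : ∀ m : ℕ, lft hf x ^ m * lft hf y = ι hf p ^ m * (lft hf y * lft hf x ^ m) := by
    intro m
    induction m with
    | zero => simp
    | succ m ih =>
      rw [pow_succ (lft hf x), mul_assoc, lft_comm x y hxy, ← hp, ← mul_assoc,
        ← (ι_central p _).eq, mul_assoc, ← mul_assoc (lft hf x ^ m), ih, pow_succ (ι hf p)]
      rw [((ι_central p (ι hf p)).pow_left m).eq]
      simp only [mul_assoc]
  have h1 : proj hf (lft hf x ^ n) = 1 := by rw [map_pow]; exact hx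
  obtain ⟨b, hb⟩ := exists_ι h1
  have h2 := key n
  rw [← hb, (ι_central b _).eq] at h2
  have h3 : ι hf p ^ n = 1 := by simpa using h2
  rw [← map_pow] at h3
  have h4 : p ^ n = 1 := ι_inj (by rw [h3, map_one])
  exact h4

/-- subgroup containment through generators -/
lemma comap_closure_le {S : Set G} {C : Subgroup (CExt f hf)} (hι : ∀ a, ι hf a ∈ C)
    (hS : ∀ x ∈ S, lft hf x ∈ C) : (Subgroup.closure S).comap (proj hf) ≤ C := by
  have h1 : Subgroup.closure S ≤ C.map (proj hf) := by
    rw [Subgroup.closure_le]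
    intro x hx
    exact ⟨lft hf x, hS x hx, rfl⟩
  intro u hu
  obtain ⟨v, hv, hvu⟩ := h1 hu
  obtain ⟨a, rfl⟩ := exists_ι' hvu.symm
  exact C.mul_mem (hι a) hv

variable (hf) in
/-- the integers `n` for which `n` times the class is (visibly) trivial -/
def splitN : AddSubgroup ℤ where
  carrier := {n | ∃ ψ : CExt f hf →* Multiplicative QZ, ∀ a, ψ (ι hf a) = a ^ n}
  zero_mem' := ⟨1, fun a => by simp⟩
  add_mem' := by
    rintro m n ⟨ψ, hψ⟩ ⟨φ, hφ⟩
    exact ⟨ψ * φ, fun a => by simp [hψ, hφ, zpow_add]⟩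
  neg_mem' := by
    rintro m ⟨ψ, hψ⟩
    exact ⟨ψ⁻¹, fun a => by simp [hψ]⟩

lemma coboundary_of_split (h : 1 ∈ splitN hf) :
    ∃ b : G → QZ, ∀ g h, f (g, h) = b g + b h - b (g * h) := by
  obtain ⟨ψ, hψ⟩ := h
  refine ⟨fun g => (ψ (lft hf g)).toAdd, fun g h => ?_⟩
  have h1 : lft hf g * lft hf h = ι hf (Multiplicative.ofAdd (f (g, h))) * lft hf (g * h) := by
    ext
    · simp only [mul_def, ι, lft, MonoidHom.coe_mk, OneHom.coe_mk, toAdd_ofAdd]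
      rw [hf.one_left (g * h)]; abel
    · simp [mul_def, ι, lft]
  have h2 := congrArg ψ h1
  rw [map_mul, map_mul, hψ, zpow_one] at h2
  have h3 := congrArg Multiplicative.toAdd h2
  simp only [toAdd_mul, toAdd_ofAdd] at h3
  rw [h3]; abel

lemma index_mem [Finite G] (Q : Subgroup G)
    (h : ∀ a, ι hf a ∈ ⁅Q.comap (proj hf), Q.comap (proj hf)⁆ → a = 1) :
    (Q.index : ℤ) ∈ splitN hf := by
  set P := Q.comap (proj hf) with hP
  have hsurj : Function.Surjective (proj hf) := fun g => ⟨lft hf g, rfl⟩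
  have hidx : P.index = Q.index := Subgroup.index_comap_of_surjective _ hsurj
  have hfi : P.FiniteIndex := ⟨by rw [hidx]; exact Subgroup.FiniteIndex.index_ne_zero⟩
  have hmem : ∀ a, ι hf a ∈ P := fun a => by
    rw [hP, Subgroup.mem_comap, proj_ι]; exact Q.one_mem
  let j : Multiplicative QZ →* Abelianization P :=
    Abelianization.of.comp ((ι hf).codRestrict P hmem)
  have hj : Function.Injective j := by
    rw [injective_iff_map_eq_one]
    intro a ha
    apply h
    have h1 : (⟨ι hf a, hmem a⟩ : P) ∈ commutator P := by
      rw [← Abelianization.ker_of]; exact ha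
    have h2 := Subgroup.mem_map_of_mem P.subtype h1
    rw [commutator_def, Subgroup.map_commutator] at h2
    simpa [← MonoidHom.range_eq_map] using h2
  let j' : QZ →+ Additive (Abelianization P) := MonoidHom.toAdditiveRight j
  obtain ⟨L, hL⟩ := CharacterModule.dual_surjective_of_injective j'.toIntLinearMap hj
    (AddMonoidHom.id QZ)
  let φ : P →* Multiplicative QZ :=
    (AddMonoidHom.toMultiplicativeRight (L : Additive (Abelianization P) →+ QZ)).comp Abelianization.of
  have hφ : ∀ a, φ ⟨ι hf a, hmem a⟩ = a := fun a => congrArg (fun (c : QZ →+ QZ) => c a.toAdd) hL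
  refine ⟨φ.transfer, fun a => ?_⟩
  rw [MonoidHom.transfer_eq_pow]
  · have : (⟨ι hf a ^ P.index, MonoidHom.transfer_eq_pow_aux _ (fun k g₀ _ => by
      rw [← ((ι_central a g₀⁻¹).pow_left k).eq, inv_mul_cancel_right])⟩ : P)
        = ⟨ι hf a, hmem a⟩ ^ P.index := rfl
    rw [this, map_pow, hφ, hidx, zpow_natCast]
  · exact fun k g₀ _ => by
      rw [← ((ι_central a g₀⁻¹).pow_left k).eq, inv_mul_cancel_right]

lemma index_mem_comm [Finite G] {x y : G} (hxy : Commute x y) (h : f (x, y) = f (y, x)) :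
    ((Subgroup.closure {x, y}).index : ℤ) ∈ splitN hf := by
  apply index_mem
  intro a ha
  set P := (Subgroup.closure {x, y}).comap (proj hf) with hP
  have hXY := lft_commute (hf := hf) hxy h
  have h1 : ∀ t ∈ ({x, y} : Set G), P ≤ Subgroup.centralizer {lft hf t} := by
    intro t ht
    apply comap_closure_le
    · intro a
      rw [Subgroup.mem_centralizer_singleton_iff]
      exact (ι_central a _).eq
    · intro t' ht'
      rw [Subgroup.mem_centralizer_singleton_iff]
      rcases ht with rfl | rfl <;> rcases ht' with rfl | rfl
      · rfl
      · exact hXY.symm.eq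
      · exact hXY.eq
      · rfl
  have h2 : P ≤ Subgroup.centralizer (P : Set (CExt f hf)) := by
    apply comap_closure_le
    · intro a
      rw [Subgroup.mem_centralizer_iff]
      intro u _
      exact (ι_central a _).symm.eq
    · intro t ht
      rw [Subgroup.mem_centralizer_iff]
      intro u hu
      exact Subgroup.mem_centralizer_singleton_iff.1 (h1 t ht hu)
  rw [Subgroup.commutator_eq_bot_iff_le_centralizer.2 h2, Subgroup.mem_bot] at ha
  exact ι_inj (by rw [ha, map_one])

/-- auxiliary subgroup -/
def auxT {E : Type} [Group E] (c u : E) : Subgroup E where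
  carrier := {q | Commute q c ∧ ⁅u, q⁆ ∈ Subgroup.zpowers c}
  one_mem' := ⟨Commute.one_left c, by simp⟩
  mul_mem' := by
    rintro q q' ⟨h1, n, hn⟩ ⟨h1', m, hm⟩
    refine ⟨h1.mul_left h1', n + m, ?_⟩
    have : ⁅u, q * q'⁆ = ⁅u, q⁆ * (q * ⁅u, q'⁆ * q⁻¹) := by
      simp only [commutatorElement_def]; group
    dsimp only at hn hm ⊢
    rw [this, ← hn, ← hm, (h1.zpow_right m).eq, mul_inv_cancel_right, zpow_add]
  inv_mem' := by
    rintro q ⟨h1, n, hn⟩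
    refine ⟨h1.inv_left, -n, ?_⟩
    have : ⁅u, q⁻¹⁆ = q⁻¹ * ⁅u, q⁆⁻¹ * q := by
      simp only [commutatorElement_def]; group
    dsimp only at hn ⊢
    rw [this, ← hn, ← zpow_neg, (h1.inv_left.zpow_right (-n)).eq, inv_mul_cancel_right]

lemma index_mem_dihedral [Finite G] {r s : G} (hrs : ⁅r, s⁆ = r ^ 2) (hr : r ^ 2 ≠ 1)
    (hr4 : r ^ 4 = 1)
    (hc : Commute (r ^ 2) s) (h : f (r ^ 2, s) = f (s, r ^ 2)) :
    ((Subgroup.closure {r, s}).index : ℤ) ∈ splitN hf := by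
  apply index_mem
  intro a ha
  set P := (Subgroup.closure {r, s}).comap (proj hf) with hP
  set R := lft hf r with hR
  set S := lft hf s with hS
  set c := ⁅R, S⁆ with hcdef
  have hpc : proj hf c = proj hf (lft hf (r ^ 2)) := by rw [hcdef, map_commutatorElement]; exact hrs
  have hpR : proj hf (R ^ 2) = proj hf (lft hf (r ^ 2)) := by rw [map_pow]; rfl
  have cS : Commute c S := commute_of_proj (v := lft hf (r ^ 2)) (w := S) hpc (lft_commute hc h)
  have RS : Commute (R ^ 2) S := commute_of_proj (v := lft hf (r ^ 2)) (w := S) hpR (lft_commute hc h)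
  have cR : Commute c R := commute_of_proj (v := R ^ 2) (hpc.trans hpR.symm) ((Commute.refl R).pow_left 2)
  have c2 : c ^ 2 = 1 := by
    have h1 : ⁅R ^ 2, S⁆ = 1 := commutatorElement_eq_one_iff_commute.2 RS
    have h2 : ⁅R ^ 2, S⁆ = R * ⁅R, S⁆ * R⁻¹ * ⁅R, S⁆ := by
      simp only [commutatorElement_def, pow_two]; group
    rw [h2, ← hcdef, ← cR.eq, mul_inv_cancel_right] at h1
    rw [pow_two, h1]
  have hT : ∀ u : CExt f hf, R ∈ auxT c u → S ∈ auxT c u → P ≤ auxT c u := by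
    intro u h1 h2
    apply comap_closure_le
    · intro a
      refine ⟨ι_central a c, ?_⟩
      rw [commutatorElement_eq_one_iff_commute.2 (ι_central a u).symm]
      exact Subgroup.one_mem _
    · rintro t (rfl | rfl)
      · exact h1
      · exact h2
  have hTR : P ≤ auxT c R := hT R ⟨cR.symm, by simp⟩ ⟨cS.symm, Subgroup.mem_zpowers c⟩
  have hTS : P ≤ auxT c S := hT S
    ⟨cR.symm, by rw [← commutatorElement_inv]; exact Subgroup.inv_mem _ (Subgroup.mem_zpowers c)⟩
    ⟨cS.symm, by simp⟩
  have hle : ⁅P, P⁆ ≤ Subgroup.zpowers c := by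
    rw [Subgroup.commutator_le]
    intro p hp q hq
    refine (hT p ⟨cR.symm, ?_⟩ ⟨cS.symm, ?_⟩ hq).2
    · rw [← commutatorElement_inv]; exact Subgroup.inv_mem _ (hTR hp).2
    · rw [← commutatorElement_inv]; exact Subgroup.inv_mem _ (hTS hp).2
  obtain ⟨k, hk⟩ := hle ha
  dsimp only at hk
  have hk2 : (r ^ 2) ^ k = 1 := by
    change (proj hf (lft hf (r ^ 2))) ^ k = 1
    rw [← hpc, ← map_zpow, hk, proj_ι]
  have hev : Even k := by
    by_contra hodd
    rw [Int.not_even_iff_odd] at hodd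
    obtain ⟨m, rfl⟩ := hodd
    rw [zpow_add, zpow_mul, zpow_one] at hk2
    have : (r ^ 2) ^ (2 : ℤ) = 1 := by
      rw [← hr4]; norm_cast; rw [← pow_mul]
    rw [this, one_zpow, one_mul] at hk2
    exact hr hk2
  obtain ⟨m, rfl⟩ := hev
  have : c ^ (m + m) = 1 := by
    rw [← two_mul, zpow_mul]; norm_cast; rw [c2, one_zpow]
  rw [this] at hk
  exact ι_inj (by rw [← hk, map_one])

end CExt

lemma qz_tor (n : ℕ) (hn : 0 < n) (t : QZ) (ht : n • t = 0) :
    ∃ k : ℤ, t = k • (((1 / n : ℚ)) : QZ) := by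
  induction t using QuotientAddGroup.induction_on with
  | H q =>
    have h1 : ((n • q : ℚ) : QZ) = 0 := ht
    rw [AddCircle.coe_eq_zero_iff] at h1
    obtain ⟨k, hk⟩ := h1
    refine ⟨k, ?_⟩
    have hn' : (n : ℚ) ≠ 0 := by positivity
    have h2 : q = k • (1 / n : ℚ) := by
      simp only [zsmul_eq_mul, nsmul_eq_mul, mul_one] at hk ⊢
      field_simp
      linarith
    rw [h2]
    rfl

lemma qz_zsmul_eq_zero (n : ℕ) (hn : 0 < n) (k : ℤ) :
    k • (((1 / n : ℚ)) : QZ) = 0 ↔ (n : ℤ) ∣ k := by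
  have hn' : (n : ℚ) ≠ 0 := by positivity
  have : k • (((1 / n : ℚ)) : QZ) = ((k • (1 / n : ℚ) : ℚ) : QZ) := rfl
  rw [this, AddCircle.coe_eq_zero_iff]
  simp only [zsmul_eq_mul, mul_one]
  constructor
  · rintro ⟨m, hm⟩
    refine ⟨m, ?_⟩
    field_simp at hm
    exact_mod_cast (by linarith : (k : ℚ) = n * m)
  · rintro ⟨m, rfl⟩
    refine ⟨m, ?_⟩
    push_cast
    field_simp

section Main

variable {G : Type} [Group G]

def pr (x y : G) : (G × G → QZ) →+ QZ where
  toFun f := f (x, y) - f (y, x)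
  map_zero' := by simp
  map_add' f g := by simp only [Pi.add_apply]; abel

lemma pr_apply (x y : G) (f : G × G → QZ) : pr x y f = f (x, y) - f (y, x) := rfl

lemma isCoc_iff (f : G × G → QZ) :
    f ∈ groupCohomology.cocycles₂ (Rep.trivial ℤ G QZ) ↔ IsCoc f := by
  rw [groupCohomology.mem_cocycles₂_iff]
  rfl

lemma mem_cob_iff (f : G × G → QZ) :
    f ∈ groupCohomology.coboundaries₂ (Rep.trivial ℤ G QZ) ↔
      ∃ b : G → QZ, ∀ g h, f (g, h) = b g + b h - b (g * h) := by
  constructor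
  · rintro ⟨b, rfl⟩
    refine ⟨b, fun g h => ?_⟩
    change b h - b (g * h) + b g = _
    abel
  · rintro ⟨b, hb⟩
    refine ⟨b, ?_⟩
    funext ⟨g, h⟩
    rw [hb]
    change b h - b (g * h) + b g = _
    abel

lemma h2_eq [Finite G] (x y r s : G) (hxy : Commute x y) (hx : x ^ 3 = 1)
    (hrs : ⁅r, s⁆ = r ^ 2) (hr : r ^ 2 ≠ 1) (hr4 : r ^ 4 = 1) (hc : Commute (r ^ 2) s)
    (hN : ∀ N : AddSubgroup ℤ, ((Subgroup.closure {x, y}).index : ℤ) ∈ N →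
      ((Subgroup.closure {r, s}).index : ℤ) ∈ N →
      (∀ w : G, ((Subgroup.closure {w, w}).index : ℤ) ∈ N) → 1 ∈ N)
    (u3 u2 : G × G → QZ) (h3 : IsCoc u3) (h2 : IsCoc u2)
    (n3 : pr x y u3 ≠ 0) (n2 : pr (r ^ 2) s u2 ≠ 0) :
    Nonempty (groupCohomology.H2 (Rep.trivial ℤ G QZ) ≃+ ZMod 6) := by
  have t3 : ∀ f, IsCoc f → 3 • pr x y f = 0 := fun f hf => CExt.pairing_torsion hf hxy 3 hx
  have t2 : ∀ f, IsCoc f → 2 • pr (r ^ 2) s f = 0 := fun f hf =>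
    CExt.pairing_torsion hf hc 2 (by rw [← pow_mul]; exact hr4)
  set Th : (G × G → QZ) →+ QZ := pr x y + pr (r ^ 2) s with hTh
  have t6 : ∀ f, IsCoc f → 6 • Th f = 0 := by
    intro f hf
    have a := t3 f hf
    have b := t2 f hf
    calc 6 • Th f = 2 • (3 • pr x y f) + 3 • (2 • pr (r ^ 2) s f) := by
          rw [hTh, AddMonoidHom.add_apply]; module
      _ = 0 := by rw [a, b]; simp
  -- kernel of Th
  have key : ∀ f, IsCoc f → (f ∈ groupCohomology.coboundaries₂ (Rep.trivial ℤ G QZ) ↔ Th f = 0) := by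
    intro f hf
    rw [mem_cob_iff]
    constructor
    · rintro ⟨b, hb⟩
      rw [hTh, AddMonoidHom.add_apply, pr_apply, pr_apply, hb, hb, hb, hb, hxy.eq, hc.eq]
      abel
    · intro h0
      have a := t3 f hf
      have b := t2 f hf
      rw [hTh, AddMonoidHom.add_apply] at h0
      have p3 : pr x y f = 0 := by
        calc pr x y f = 3 • pr x y f - 2 • (pr x y f + pr (r ^ 2) s f) + 2 • pr (r ^ 2) s f := by
              module
          _ = 0 := by rw [a, b, h0]; simp
      have p2 : pr (r ^ 2) s f = 0 := by rwa [p3, zero_add] at h0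
      apply CExt.coboundary_of_split (hf := hf)
      apply hN
      · exact CExt.index_mem_comm hxy (sub_eq_zero.1 p3)
      · exact CExt.index_mem_dihedral hrs hr hr4 hc (sub_eq_zero.1 p2)
      · intro w
        exact CExt.index_mem_comm (Commute.refl w) rfl
  -- the generator
  obtain ⟨u, hu, hu6⟩ : ∃ u, IsCoc u ∧ Th u = (((1 / (6 : ℕ) : ℚ)) : QZ) := by
    obtain ⟨a, ha⟩ := qz_tor 3 (by norm_num) _ (t3 u3 h3)
    obtain ⟨b, hb⟩ := qz_tor 2 (by norm_num) _ (t2 u2 h2)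
    have ha' : ¬ ((3 : ℕ) : ℤ) ∣ a := fun h => n3 (by rw [ha]; exact (qz_zsmul_eq_zero 3 (by norm_num) a).2 h)
    have hb' : ¬ ((2 : ℕ) : ℤ) ∣ b := fun h => n2 (by rw [hb]; exact (qz_zsmul_eq_zero 2 (by norm_num) b).2 h)
    set e : QZ := (((1 / (6 : ℕ) : ℚ)) : QZ) with he
    have e3 : (((1 / (3 : ℕ) : ℚ)) : QZ) = (2 : ℤ) • e := by
      have : (1 / (3 : ℕ) : ℚ) = (2 : ℤ) • (1 / (6 : ℕ) : ℚ) := by norm_num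
      rw [this]; rfl
    have e2 : (((1 / (2 : ℕ) : ℚ)) : QZ) = (3 : ℤ) • e := by
      have : (1 / (2 : ℕ) : ℚ) = (3 : ℤ) • (1 / (6 : ℕ) : ℚ) := by norm_num
      rw [this]; rfl
    rw [e3] at ha
    rw [e2] at hb
    refine ⟨(8 * a) • u3 + (3 * b) • u2, ?_, ?_⟩
    · rw [← isCoc_iff] at h3 h2 ⊢
      exact add_mem (Submodule.smul_mem _ _ h3) (Submodule.smul_mem _ _ h2)
    · have a2 := t3 u2 h2
      have b2 := t2 u3 h3
      have : Th ((8 * a) • u3 + (3 * b) • u2) = (16 * a * a + 9 * b * b) • e := by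
        rw [hTh, AddMonoidHom.add_apply, map_add, map_add, map_zsmul, map_zsmul, map_zsmul,
          map_zsmul, ha, hb]
        calc _ = (16 * a * a + 9 * b * b) • e + b • (3 • (pr x y u2)) + (4 * a) • (2 • (pr (r ^ 2) s u3)) := by module
          _ = _ := by rw [a2, b2]; simp
      rw [this]
      have hd : ((6 : ℕ) : ℤ) ∣ (16 * a * a + 9 * b * b - 1) := by
        have ha2 : a % 3 = 1 ∨ a % 3 = 2 := by omega
        have hb2 : b % 2 = 1 := by omega
        obtain ⟨c, hc1⟩ : ∃ c, a = 3 * c + a % 3 := ⟨a / 3, by omega⟩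
        obtain ⟨d, hd1⟩ : ∃ d, b = 2 * d + 1 := ⟨b / 2, by omega⟩
        have hA : (3 : ℤ) ∣ (16 * a * a + 9 * b * b - 1) := by
          rcases ha2 with h | h <;> rw [h] at hc1 <;> rw [hc1]
          · exact ⟨48 * c ^ 2 + 32 * c + 5 + 3 * b * b, by ring⟩
          · exact ⟨48 * c ^ 2 + 64 * c + 21 + 3 * b * b, by ring⟩
        have hB : (2 : ℤ) ∣ (16 * a * a + 9 * b * b - 1) := by
          rw [hd1]
          exact ⟨8 * a * a + 18 * d ^ 2 + 18 * d + 4, by ring⟩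
        push_cast
        omega
      have := (qz_zsmul_eq_zero 6 (by norm_num) _).2 hd
      rw [← he, sub_smul, one_smul, sub_eq_zero] at this
      exact this
  let U : groupCohomology.cocycles₂ (Rep.trivial ℤ G QZ) := ⟨u, (isCoc_iff u).2 hu⟩
  let π := (groupCohomology.H2π (Rep.trivial ℤ G QZ)).hom
  have hπ : ∀ w : groupCohomology.cocycles₂ (Rep.trivial ℤ G QZ), π w = 0 ↔ Th w.1 = 0 := by
    intro w
    rw [← key _ ((isCoc_iff _).1 w.2)]
    exact groupCohomology.H2π_eq_zero_iff _
  have hπn : ∀ n : ℤ, n • π U = 0 ↔ (6 : ℤ) ∣ n := by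
    intro n
    have : n • π U = π (n • U) := (map_zsmul π n U).symm
    rw [this, hπ]
    change Th (n • u) = 0 ↔ _
    rw [map_zsmul, hu6]
    exact qz_zsmul_eq_zero 6 (by norm_num) n
  let φ : ZMod 6 →+ groupCohomology.H2 (Rep.trivial ℤ G QZ) :=
    ZMod.lift 6 ⟨(zmultiplesHom _ (π U)), by
      simpa using (hπn 6).2 (dvd_refl _)⟩
  have hφ : ∀ n : ℤ, φ (n : ZMod 6) = n • π U := by
    intro n
    simp [φ]
  refine ⟨(AddEquiv.ofBijective φ ⟨?_, ?_⟩).symm⟩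
  · rw [injective_iff_map_eq_zero]
    intro z hz
    obtain ⟨n, rfl⟩ := ZMod.intCast_surjective z
    rw [hφ, hπn] at hz
    exact (ZMod.intCast_zmod_eq_zero_iff_dvd n 6).2 hz
  · intro z
    induction z using groupCohomology.H2_induction_on with
    | h w =>
      obtain ⟨k, hk⟩ := qz_tor 6 (by norm_num) _ (t6 w.1 ((isCoc_iff _).1 w.2))
      refine ⟨(k : ZMod 6), ?_⟩
      rw [hφ]
      have h0 : π (w - k • U) = 0 := by
        rw [hπ]
        change Th (w.1 - k • u) = 0
        rw [map_sub, map_zsmul, hu6, hk, sub_self]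
      rw [map_sub, map_zsmul, sub_eq_zero] at h0
      exact h0.symm

end Main

section Cor

lemma cor_coc {G ι A : Type} [Group G] [Fintype ι] [AddCommGroup A] (P : G → Prop) (t : ι → G)
    (idx : G → ι) (h1 : ∀ g, P ((t (idx g))⁻¹ * g)) (h2 : ∀ g p, P p → idx (g * p) = idx g)
    (h3 : ∀ k, idx (t k) = k) (c : G × G → A)
    (hc : ∀ g h k, P g → P h → P k → c (g * h, k) + c (g, h) = c (h, k) + c (g, h * k)) :
    IsCoc (fun q : G × G => ∑ k : ι,
      c ((t (idx (q.1 * t (idx (q.2 * t k)))))⁻¹ * (q.1 * t (idx (q.2 * t k))),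
        (t (idx (q.2 * t k)))⁻¹ * (q.2 * t k))) := by
  have ha : ∀ g h k, idx (g * h * t k) = idx (g * t (idx (h * t k))) := by
    intro g h k
    have := h2 (g * t (idx (h * t k))) _ (h1 (h * t k))
    rw [← this]
    congr 1
    group
  have hp : ∀ g h k, (t (idx (g * h * t k)))⁻¹ * (g * h * t k) =
      ((t (idx (g * t (idx (h * t k)))))⁻¹ * (g * t (idx (h * t k)))) *
        ((t (idx (h * t k)))⁻¹ * (h * t k)) := by
    intro g h k
    rw [ha]
    group
  intro g h k
  have hb : Function.Bijective (fun j => idx (k * t j)) := by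
    refine Function.bijective_iff_has_inverse.2 ⟨fun j => idx (k⁻¹ * t j), fun j => ?_, fun j => ?_⟩
    · change idx (k⁻¹ * t (idx (k * t j))) = j
      rw [← ha]; simp [h3]
    · change idx (k * t (idx (k⁻¹ * t j))) = j
      rw [← ha]; simp [h3]
  dsimp only
  have e : ∑ j : ι, c ((t (idx (g * t (idx (h * t j)))))⁻¹ * (g * t (idx (h * t j))),
        (t (idx (h * t j)))⁻¹ * (h * t j)) =
      ∑ j : ι, c ((t (idx (g * t (idx (h * t (idx (k * t j)))))))⁻¹ * (g * t (idx (h * t (idx (k * t j))))),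
        (t (idx (h * t (idx (k * t j)))))⁻¹ * (h * t (idx (k * t j)))) :=
    (Function.Bijective.sum_comp hb (fun j => c ((t (idx (g * t (idx (h * t j)))))⁻¹ * (g * t (idx (h * t j))),
        (t (idx (h * t j)))⁻¹ * (h * t j)))).symm
  rw [e, ← Finset.sum_add_distrib, ← Finset.sum_add_distrib]
  refine Finset.sum_congr rfl fun j _ => ?_
  have := hc _ _ _ (h1 (g * t (idx (h * t (idx (k * t j)))))) (h1 (h * t (idx (k * t j)))) (h1 (k * t j))
  rw [← hp, ← hp] at this
  rw [this, ha h k j]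

/-- images of the coset representatives, as decimal digits -/
def tabL : List ℕ :=
  [123456, 134256, 142356, 153246, 162345, 231456, 243156, 251346, 263145, 341256, 352146,
   361245, 451236, 462135, 561234, 1234056, 1240356, 1253046, 1260345, 1342056, 1350246,
   1362045, 1452036, 1460235, 1562034, 2340156, 2351046, 2360145, 2450136, 2461035,
   2560134, 3451026, 3460125, 3561024, 4560123]

def invL : List ℕ :=
  [123456, 142356, 134256, 143526, 134562, 312456, 413256, 314526, 413562, 341256, 431526,
   341562, 345126, 435162, 345612, 4012356, 3014256, 4013526, 3014562, 4031256, 3041526,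
   4031562, 4035126, 3045162, 4035612, 3401256, 4301526, 3401562, 3405126, 4305162,
   3405612, 4350126, 3450162, 4350612, 3456012]

def maskL : List ℕ :=
  [0, 0, 0, 0, 0, 0, 0, 0, 0, 0, 0, 1, 0, 5, 15, 0, 0, 0, 0, 2, 0, 6, 16, 0, 0, 9, 19, 0,
   25, 0, 0, 0, 0, 0, 0, 3, 0, 7, 17, 0, 0, 10, 20, 0, 26, 0, 0, 0, 0, 12, 22, 0, 28, 0,
   0, 0, 31, 0, 0, 0, 0, 0, 0, 0, 0, 0, 0, 4, 0, 8, 18, 0, 0, 11, 21, 0, 27, 0, 0, 0, 0,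
   13, 23, 0, 29, 0, 0, 0, 32, 0, 0, 0, 0, 0, 0, 0, 0, 14, 24, 0, 30, 0, 0, 0, 33, 0, 0,
   0, 0, 0, 0, 0, 34]

def dig (n i : ℕ) : Fin 7 := Fin.ofNat 7 (n / 10 ^ (6 - i) % 10)

lemma dig_inv : ∀ k : Fin 35, ∀ i : Fin 7,
    dig (invL.getD k 0) (dig (tabL.getD k 0) i) = i ∧
    dig (tabL.getD k 0) (dig (invL.getD k 0) i) = i := by
  decide +kernel

def tP (k : Fin 35) : Equiv.Perm (Fin 7) where
  toFun i := dig (tabL.getD k 0) i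
  invFun i := dig (invL.getD k 0) i
  left_inv i := (dig_inv k i).1
  right_inv i := (dig_inv k i).2

lemma tP_even : ∀ k : Fin 35, Equiv.Perm.sign (tP k) = 1 := by
  decide +kernel

def tA (k : Fin 35) : alternatingGroup (Fin 7) := ⟨tP k, tP_even k⟩

def look (a b c : Fin 7) : Fin 35 := Fin.ofNat 35 (maskL.getD (2 ^ a.1 + 2 ^ b.1 + 2 ^ c.1) 0)

def idxA (g : alternatingGroup (Fin 7)) : Fin 35 := look (g.1 0) (g.1 1) (g.1 2)

def PA (g : alternatingGroup (Fin 7)) : Prop := (g.1 0).1 < 3 ∧ (g.1 1).1 < 3 ∧ (g.1 2).1 < 3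

lemma look_spec : ∀ a b c : Fin 7, a ≠ b → a ≠ c → b ≠ c →
    ((tP (look a b c)).symm a).1 < 3 ∧ ((tP (look a b c)).symm b).1 < 3 ∧
      ((tP (look a b c)).symm c).1 < 3 := by
  decide +kernel

lemma idx_h1 (g : alternatingGroup (Fin 7)) : PA ((tA (idxA g))⁻¹ * g) := by
  have hg := g.1.injective
  exact look_spec (g.1 0) (g.1 1) (g.1 2) (fun h => absurd (hg h) (by decide))
    (fun h => absurd (hg h) (by decide)) (fun h => absurd (hg h) (by decide))

lemma lt3 : ∀ a : Fin 7, a.1 < 3 → a = 0 ∨ a = 1 ∨ a = 2 := by decide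

lemma idx_h2 (g p : alternatingGroup (Fin 7)) (hp : PA p) : idxA (g * p) = idxA g := by
  obtain ⟨h0, h1, h2⟩ := hp
  have hi := p.1.injective
  have n01 : p.1 0 ≠ p.1 1 := fun h => absurd (hi h) (by decide)
  have n02 : p.1 0 ≠ p.1 2 := fun h => absurd (hi h) (by decide)
  have n12 : p.1 1 ≠ p.1 2 := fun h => absurd (hi h) (by decide)
  change look (g.1 (p.1 0)) (g.1 (p.1 1)) (g.1 (p.1 2)) = look (g.1 0) (g.1 1) (g.1 2)
  rcases lt3 _ h0 with e0 | e0 | e0 <;> rcases lt3 _ h1 with e1 | e1 | e1 <;>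
    rcases lt3 _ h2 with e2 | e2 | e2 <;>
    first
    | exact absurd (e0.trans e1.symm) n01
    | exact absurd (e0.trans e2.symm) n02
    | exact absurd (e1.trans e2.symm) n12
    | (rw [e0, e1, e2]; done)
    | (rw [e0, e1, e2]; unfold look; congr 2; omega)

lemma idx_h3 : ∀ k : Fin 35, idxA (tA k) = k := by
  decide +kernel

lemma PA_split (g : alternatingGroup (Fin 7)) (hg : PA g) :
    ∃ (σ : Equiv.Perm (Fin 3)) (τ : Equiv.Perm (Fin 4)), Equiv.Perm.sign σ = Equiv.Perm.sign τ ∧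
      (∀ a : Fin 3, g.1 (Fin.castAdd 4 a) = Fin.castAdd 4 (σ a)) ∧
      (∀ b : Fin 4, g.1 (Fin.natAdd 3 b) = Fin.natAdd 3 (τ b)) := by
  let e : Fin 3 ⊕ Fin 4 ≃ Fin 7 := finSumFinEquiv
  let q : Equiv.Perm (Fin 3 ⊕ Fin 4) := e.symm.permCongr g.1
  have hq : Set.MapsTo q (Set.range Sum.inl) (Set.range Sum.inl) := by
    rintro _ ⟨a, rfl⟩
    have : (g.1 (Fin.castAdd 4 a)).1 < 3 := by
      obtain ⟨h0, h1, h2⟩ := hg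
      fin_cases a
      · exact h0
      · exact h1
      · exact h2
    refine ⟨⟨(g.1 (Fin.castAdd 4 a)).1, this⟩, ?_⟩
    change _ = e.symm (g.1 (e (Sum.inl a)))
    rw [Equiv.eq_symm_apply]
    rfl
  obtain ⟨⟨σ, τ⟩, h⟩ := Equiv.Perm.mem_sumCongrHom_range_of_perm_mapsTo_inl hq
  change Equiv.Perm.sumCongr σ τ = q at h
  refine ⟨σ, τ, ?_, ?_, ?_⟩
  · have h1 : Equiv.Perm.sign q = 1 := by
      rw [Equiv.Perm.sign_permCongr]
      exact g.2
    rw [← h, Equiv.Perm.sign_sumCongr] at h1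
    rcases Int.units_eq_one_or (Equiv.Perm.sign σ) with e1 | e1 <;>
      rcases Int.units_eq_one_or (Equiv.Perm.sign τ) with e2 | e2 <;>
      rw [e1, e2] at h1 ⊢ <;> exact absurd h1 (by decide)
  · intro a
    have := congrArg (fun f => e (f (Sum.inl a))) h
    simp only [q, Equiv.permCongr_apply, Equiv.symm_symm, Equiv.apply_symm_apply] at this
    exact this.symm
  · intro b
    have := congrArg (fun f => e (f (Sum.inr b))) h
    simp only [q, Equiv.permCongr_apply, Equiv.symm_symm, Equiv.apply_symm_apply] at this
    exact this.symm

/-- the 2-class -/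
def Btab (i j : Fin 4) : ZMod 2 :=
  !![0, 0, 0, 0; 1, 0, 1, 0; 1, 0, 0, 1; 1, 1, 0, 0] i j

def ne2 (i j : Fin 4) : ZMod 2 := if i = j then 0 else 1

def od (σ : Equiv.Perm (Fin 3)) : ZMod 2 := if σ 1 = σ 0 + 1 then 0 else 1

lemma B_inv : ∀ (τ : Equiv.Perm (Fin 4)) (σ : Equiv.Perm (Fin 3)),
    Equiv.Perm.sign σ = Equiv.Perm.sign τ → ∀ b c : Fin 4,
    Btab (τ b) (τ c) + Btab (τ 0) (τ b) + od σ * (ne2 b c + ne2 b 0) =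
      Btab b c + Btab (τ 0) (τ c) + od σ * ne2 c 0 := by
  decide +kernel

def lab (i j : Fin 4) : ZMod 3 :=
  !![0, 0, 1, 2; 0, 0, 2, 1; 1, 2, 0, 0; 2, 1, 0, 0] i j

lemma lab_inv : ∀ (τ : Equiv.Perm (Fin 4)) (i j : Fin 4), i ≠ j →
    lab (τ i) (τ j) = lab (τ 0) (τ 1) + ((Equiv.Perm.sign τ : ℤ) : ZMod 3) * lab i j := by
  decide +kernel

def z3 (a : Fin 3) : ZMod 3 := a

lemma z3_inv : ∀ (σ : Equiv.Perm (Fin 3)) (a : Fin 3),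
    z3 (σ a) = z3 (σ 0) + ((Equiv.Perm.sign σ : ℤ) : ZMod 3) * z3 a := by
  decide +kernel

def uL (i : Fin 7) : Fin 3 := Fin.ofNat 3 i.1
def uR (i : Fin 7) : Fin 4 := Fin.ofNat 4 (i.1 - 3)

lemma uL_cast : ∀ a : Fin 3, uL (Fin.castAdd 4 a) = a := by decide
lemma uR_nat : ∀ b : Fin 4, uR (Fin.natAdd 3 b) = b := by decide

def odA (g : Equiv.Perm (Fin 7)) : ZMod 2 := if uL (g 1) = uL (g 0) + 1 then 0 else 1

def c2 (q : alternatingGroup (Fin 7) × alternatingGroup (Fin 7)) : ZMod 2 :=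
  Btab (uR (q.1.1 3)) (uR (q.1.1 (q.2.1 3))) + odA q.1.1 * ne2 (uR (q.2.1 3)) 0

def w3 (g h : Equiv.Perm (Fin 7)) : ZMod 3 :=
  z3 (uL (g 0)) * lab (uR (h 3)) (uR (h 4)) - z3 (uL (h 0)) * lab (uR (g 3)) (uR (g 4))

def c3 (q : alternatingGroup (Fin 7) × alternatingGroup (Fin 7)) : ZMod 3 :=
  w3 q.1.1 (q.1 * q.2).1

lemma od_mul : ∀ σ ρ : Equiv.Perm (Fin 3), od (σ * ρ) = od σ + od ρ := by
  decide +kernel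

lemma ne2_inv : ∀ (τ : Equiv.Perm (Fin 4)) (a b : Fin 4), ne2 (τ a) (τ b) = ne2 a b := by
  intro τ a b
  unfold ne2
  simp

structure Spl (g : alternatingGroup (Fin 7)) (σ : Equiv.Perm (Fin 3)) (τ : Equiv.Perm (Fin 4)) :
    Prop where
  sgn : Equiv.Perm.sign σ = Equiv.Perm.sign τ
  l : ∀ a : Fin 3, g.1 (Fin.castAdd 4 a) = Fin.castAdd 4 (σ a)
  r : ∀ b : Fin 4, g.1 (Fin.natAdd 3 b) = Fin.natAdd 3 (τ b)

lemma Spl.mul {g h : alternatingGroup (Fin 7)} {σ σ' : Equiv.Perm (Fin 3)}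
    {τ τ' : Equiv.Perm (Fin 4)} (H : Spl g σ τ) (K : Spl h σ' τ') : Spl (g * h) (σ * σ') (τ * τ') where
  sgn := by rw [Equiv.Perm.sign_mul, Equiv.Perm.sign_mul, H.sgn, K.sgn]
  l a := by
    change g.1 (h.1 _) = _
    rw [K.l, H.l]; rfl
  r a := by
    change g.1 (h.1 _) = _
    rw [K.r, H.r]; rfl

lemma c2_spl {g h : alternatingGroup (Fin 7)} {σ σ' : Equiv.Perm (Fin 3)}
    {τ τ' : Equiv.Perm (Fin 4)} (H : Spl g σ τ) (K : Spl h σ' τ') :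
    c2 (g, h) = Btab (τ 0) (τ (τ' 0)) + od σ * ne2 (τ' 0) 0 := by
  have a0 : g.1 0 = Fin.castAdd 4 (σ 0) := H.l 0
  have a1 : g.1 1 = Fin.castAdd 4 (σ 1) := H.l 1
  have b0 : g.1 3 = Fin.natAdd 3 (τ 0) := H.r 0
  have d0 : h.1 3 = Fin.natAdd 3 (τ' 0) := K.r 0
  unfold c2 odA od
  dsimp only
  rw [a0, a1, b0, d0, H.r, uL_cast, uL_cast, uR_nat, uR_nat, uR_nat]

lemma w3_spl {g h : alternatingGroup (Fin 7)} {σ σ' : Equiv.Perm (Fin 3)}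
    {τ τ' : Equiv.Perm (Fin 4)} (H : Spl g σ τ) (K : Spl h σ' τ') :
    w3 g.1 h.1 = z3 (σ 0) * lab (τ' 0) (τ' 1) - z3 (σ' 0) * lab (τ 0) (τ 1) := by
  have a0 : g.1 0 = Fin.castAdd 4 (σ 0) := H.l 0
  have b0 : g.1 3 = Fin.natAdd 3 (τ 0) := H.r 0
  have b1 : g.1 4 = Fin.natAdd 3 (τ 1) := H.r 1
  have e0 : h.1 0 = Fin.castAdd 4 (σ' 0) := K.l 0
  have d0 : h.1 3 = Fin.natAdd 3 (τ' 0) := K.r 0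
  have d1 : h.1 4 = Fin.natAdd 3 (τ' 1) := K.r 1
  unfold w3
  rw [a0, b0, b1, e0, d0, d1]
  simp only [uL_cast, uR_nat]

lemma c2_coc (g h k : alternatingGroup (Fin 7)) (hg : PA g) (hh : PA h) (hk : PA k) :
    c2 (g * h, k) + c2 (g, h) = c2 (h, k) + c2 (g, h * k) := by
  obtain ⟨σ, τ, H1, H2, H3⟩ := PA_split g hg
  obtain ⟨σ', τ', H1', H2', H3'⟩ := PA_split h hh
  obtain ⟨σ'', τ'', H1'', H2'', H3''⟩ := PA_split k hk
  have H : Spl g σ τ := ⟨H1, H2, H3⟩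
  have K : Spl h σ' τ' := ⟨H1', H2', H3'⟩
  have L : Spl k σ'' τ'' := ⟨H1'', H2'', H3''⟩
  rw [c2_spl (H.mul K) L, c2_spl H K, c2_spl K L, c2_spl H (K.mul L), od_mul]
  have := B_inv τ σ H1 (τ' 0) (τ' (τ'' 0))
  have e : ne2 (τ' 0) (τ' (τ'' 0)) = ne2 (τ'' 0) 0 := by
    rw [ne2_inv]; unfold ne2; simp [eq_comm]
  rw [e] at this
  simp only [Equiv.Perm.mul_apply] at *
  linear_combination this

lemma c3_coc (g h k : alternatingGroup (Fin 7)) (hg : PA g) (hh : PA h) (hk : PA k) :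
    c3 (g * h, k) + c3 (g, h) = c3 (h, k) + c3 (g, h * k) := by
  obtain ⟨σ, τ, H1, H2, H3⟩ := PA_split g hg
  obtain ⟨σ', τ', H1', H2', H3'⟩ := PA_split h hh
  obtain ⟨σ'', τ'', H1'', H2'', H3''⟩ := PA_split k hk
  have H : Spl g σ τ := ⟨H1, H2, H3⟩
  have K : Spl h σ' τ' := ⟨H1', H2', H3'⟩
  have L : Spl k σ'' τ'' := ⟨H1'', H2'', H3''⟩
  unfold c3
  dsimp only
  rw [w3_spl (H.mul K) ((H.mul K).mul L), w3_spl H (H.mul K), w3_spl K (K.mul L),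
    w3_spl H (H.mul (K.mul L))]
  have i1 : τ' 0 ≠ τ' 1 := fun h => absurd (τ'.injective h) (by decide)
  have i2 : τ' (τ'' 0) ≠ τ' (τ'' 1) :=
    fun h => absurd (τ''.injective (τ'.injective h)) (by decide)
  simp only [Equiv.Perm.mul_apply]
  rw [lab_inv τ _ _ i1, lab_inv τ _ _ i2, z3_inv σ (σ' 0), z3_inv σ (σ' (σ'' 0)), H1]
  have hs : (((Equiv.Perm.sign τ : ℤ) : ZMod 3)) * ((Equiv.Perm.sign τ : ℤ) : ZMod 3) = 1 := by
    rcases Int.units_eq_one_or (Equiv.Perm.sign τ) with e | e <;> rw [e] <;> decide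
  linear_combination (z3 (σ' 0) * lab (τ' (τ'' 0)) (τ' (τ'' 1)) -
    z3 (σ' (σ'' 0)) * lab (τ' 0) (τ' 1)) * hs

def F2 (q : alternatingGroup (Fin 7) × alternatingGroup (Fin 7)) : ZMod 2 := ∑ k : Fin 35,
  c2 ((tA (idxA (q.1 * tA (idxA (q.2 * tA k)))))⁻¹ * (q.1 * tA (idxA (q.2 * tA k))),
        (tA (idxA (q.2 * tA k)))⁻¹ * (q.2 * tA k))

def F3 (q : alternatingGroup (Fin 7) × alternatingGroup (Fin 7)) : ZMod 3 := ∑ k : Fin 35,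
  c3 ((tA (idxA (q.1 * tA (idxA (q.2 * tA k)))))⁻¹ * (q.1 * tA (idxA (q.2 * tA k))),
        (tA (idxA (q.2 * tA k)))⁻¹ * (q.2 * tA k))

lemma F2_coc : IsCoc F2 := cor_coc PA tA idxA idx_h1 idx_h2 idx_h3 c2 c2_coc
lemma F3_coc : IsCoc F3 := cor_coc PA tA idxA idx_h1 idx_h2 idx_h3 c3 c3_coc

/-- permutation from digits -/
def dP (n m : ℕ) (h : ∀ i : Fin 7, dig m (dig n i) = i ∧ dig n (dig m i) = i) :
    Equiv.Perm (Fin 7) where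
  toFun i := dig n i
  invFun i := dig m i
  left_inv i := (h i).1
  right_inv i := (h i).2

def xA : alternatingGroup (Fin 7) := ⟨dP 1203456 2013456 (by decide +kernel), by
  change Equiv.Perm.sign _ = 1; decide +kernel⟩
def yA : alternatingGroup (Fin 7) := ⟨dP 0124536 0125346 (by decide +kernel), by
  change Equiv.Perm.sign _ = 1; decide +kernel⟩
def rA : alternatingGroup (Fin 7) := ⟨dP 2310546 3201546 (by decide +kernel), by
  change Equiv.Perm.sign _ = 1; decide +kernel⟩
def sA : alternatingGroup (Fin 7) := ⟨dP 2301456 2301456 (by decide +kernel), by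
  change Equiv.Perm.sign _ = 1; decide +kernel⟩

lemma F3_ne : F3 (xA, yA) - F3 (yA, xA) ≠ 0 := by decide +kernel
lemma F2_ne : F2 (rA ^ 2, sA) - F2 (sA, rA ^ 2) ≠ 0 := by decide +kernel

end Cor

section Fin5

def wA : alternatingGroup (Fin 7) := ⟨dP 1234056 4012356 (by decide +kernel), by
  change Equiv.Perm.sign _ = 1; decide +kernel⟩
def vA : alternatingGroup (Fin 7) := ⟨dP 1234560 6012345 (by decide +kernel), by
  change Equiv.Perm.sign _ = 1; decide +kernel⟩

lemma dvd_card_closure {G : Type} [Group G] [Finite G] (x y : G) (n m : ℕ) [NeZero n] [NeZero m]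
    (hi : ∀ a b : Fin n × Fin m, x ^ a.1.1 * y ^ a.2.1 = x ^ b.1.1 * y ^ b.2.1 → a = b)
    (hm : ∀ a b : Fin n × Fin m, ∃ c : Fin n × Fin m,
      (x ^ a.1.1 * y ^ a.2.1) * (x ^ b.1.1 * y ^ b.2.1) = x ^ c.1.1 * y ^ c.2.1) :
    n * m ∣ Nat.card (Subgroup.closure {x, y}) := by
  let f : Fin n × Fin m → G := fun a => x ^ a.1.1 * y ^ a.2.1
  let M : Submonoid G :=
    { carrier := Set.range f
      mul_mem' := by
        rintro _ _ ⟨a, rfl⟩ ⟨b, rfl⟩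
        obtain ⟨c, hc⟩ := hm a b
        exact ⟨c, hc.symm⟩
      one_mem' := ⟨(0, 0), by simp [f]⟩ }
  let K : Subgroup G :=
    { M with
      inv_mem' := by
        intro g hg
        have : g⁻¹ ∈ Submonoid.powers g := by
          obtain ⟨k, hk, hk1⟩ := (isOfFinOrder_iff_pow_eq_one.1 (isOfFinOrder_of_finite g))
          refine ⟨k - 1, ?_⟩
          change g ^ (k - 1) = g⁻¹
          rw [eq_inv_iff_mul_eq_one, ← pow_succ, Nat.sub_add_cancel hk, hk1]
        exact (Submonoid.powers_le.2 hg) this }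
  have hK : Nat.card K = n * m := by
    have : Nat.card K = Nat.card (Set.range f) := rfl
    rw [this, Nat.card_range_of_injective (fun a b h => hi a b h)]
    simp
  rw [← hK]
  apply Subgroup.card_dvd_of_le
  rintro _ ⟨a, rfl⟩
  exact mul_mem (pow_mem (Subgroup.subset_closure (by simp)) _)
    (pow_mem (Subgroup.subset_closure (by simp)) _)

lemma card9 : 9 ∣ Nat.card (Subgroup.closure {xA, yA}) :=
  dvd_card_closure xA yA 3 3 (by decide +kernel) (by decide +kernel)
lemma card8 : 8 ∣ Nat.card (Subgroup.closure {rA, sA}) :=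
  dvd_card_closure rA sA 4 2 (by decide +kernel) (by decide +kernel)
lemma card5 : 5 ∣ Nat.card (Subgroup.closure {wA, wA}) := by
  have : orderOf wA = 5 := by
    have : Fact (Nat.Prime 5) := ⟨by norm_num⟩
    exact orderOf_eq_prime (by decide +kernel) (by decide +kernel)
  exact this.symm.dvd.trans (Subgroup.orderOf_dvd_natCard _ (Subgroup.subset_closure (by simp)))
lemma card7 : 7 ∣ Nat.card (Subgroup.closure {vA, vA}) := by
  have : orderOf vA = 7 := by
    have : Fact (Nat.Prime 7) := ⟨by norm_num⟩
    exact orderOf_eq_prime (by decide +kernel) (by decide +kernel)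
  exact this.symm.dvd.trans (Subgroup.orderOf_dvd_natCard _ (Subgroup.subset_closure (by simp)))

lemma index_in {G : Type} [Group G] [Finite G] (φ : G →* alternatingGroup (Fin 7))
    (hφ : Function.Injective φ) (x y : G) (x' y' : alternatingGroup (Fin 7)) (hx : φ x = x')
    (hy : φ y = y') (d e : ℕ) (hd : d ∣ Nat.card (Subgroup.closure {x', y'}))
    (hG : Nat.card G = d * e) (hd0 : 0 < d) (N : AddSubgroup ℤ)
    (hN : ((Subgroup.closure {x, y}).index : ℤ) ∈ N) : (e : ℤ) ∈ N := by
  have h1 : Subgroup.closure {x', y'} = (Subgroup.closure {x, y}).map φ := by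
    rw [MonoidHom.map_closure, Set.image_pair, hx, hy]
  rw [h1, Subgroup.card_map_of_injective hφ] at hd
  obtain ⟨c, hc⟩ := hd
  have h2 := (Subgroup.closure {x, y}).card_mul_index
  rw [hc, hG, mul_assoc] at h2
  have h3 := Nat.eq_of_mul_eq_mul_left hd0 h2
  rw [← h3]
  push_cast
  rw [← smul_eq_mul]
  exact N.zsmul_mem hN _

def iq (n : ℕ) : ZMod n →+ QZ := ZMod.lift n ⟨zmultiplesHom _ (((1 / n : ℚ)) : QZ), by
  rcases Nat.eq_zero_or_pos n with rfl | h
  · simp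
  · simpa using (qz_zsmul_eq_zero n h n).2 (dvd_refl _)⟩

lemma iq_inj (n : ℕ) (hn : 0 < n) (z : ZMod n) (hz : iq n z = 0) : z = 0 := by
  obtain ⟨k, rfl⟩ := ZMod.intCast_surjective z
  have : iq n (k : ZMod n) = k • (((1 / n : ℚ)) : QZ) := by simp [iq]
  rw [this, qz_zsmul_eq_zero n hn] at hz
  exact (ZMod.intCast_zmod_eq_zero_iff_dvd k n).2 hz

lemma final {G : Type} [Group G] [Finite G] (φ : G →* alternatingGroup (Fin 7))
    (hφ : Function.Injective φ) (x y r s : G) (hx : φ x = xA) (hy : φ y = yA) (hr : φ r = rA)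
    (hs : φ s = sA)
    (hN : ∀ N : AddSubgroup ℤ, ((Subgroup.closure {x, y}).index : ℤ) ∈ N →
      ((Subgroup.closure {r, s}).index : ℤ) ∈ N →
      (∀ w : G, ((Subgroup.closure {w, w}).index : ℤ) ∈ N) → 1 ∈ N) :
    Nonempty (groupCohomology.H2 (Rep.trivial ℤ G QZ) ≃+ ZMod 6) := by
  refine h2_eq x y r s ?_ ?_ ?_ ?_ ?_ ?_ hN (fun q => iq 3 (F3 (φ q.1, φ q.2)))
    (fun q => iq 2 (F2 (φ q.1, φ q.2))) ?_ ?_ ?_ ?_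
  · apply hφ; rw [map_mul, map_mul, hx, hy]; decide +kernel
  · apply hφ; rw [map_pow, map_one, hx]; decide +kernel
  · apply hφ; rw [map_commutatorElement, map_pow, hr, hs]; decide +kernel
  · intro h
    have := congrArg φ h
    rw [map_pow, map_one, hr] at this
    exact absurd this (by decide +kernel)
  · apply hφ; rw [map_pow, map_one, hr]; decide +kernel
  · apply hφ; rw [map_mul, map_mul, map_pow, hr, hs]; decide +kernel
  · intro g h k
    have := F3_coc (φ g) (φ h) (φ k)
    simp only [map_mul, ← map_add, this]
  · intro g h k
    have := F2_coc (φ g) (φ h) (φ k)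
    simp only [map_mul, ← map_add, this]
  · rw [pr_apply]
    dsimp only
    rw [← map_sub, hx, hy]
    exact fun h => F3_ne (iq_inj 3 (by norm_num) _ h)
  · rw [pr_apply]
    dsimp only
    rw [← map_sub, map_pow, hr, hs]
    exact fun h => F2_ne (iq_inj 2 (by norm_num) _ h)

lemma cardA7 : Nat.card (alternatingGroup (Fin 7)) = 2520 := by
  rw [nat_card_alternatingGroup]; simp; decide
lemma cardA6 : Nat.card (alternatingGroup (Fin 6)) = 360 := by
  rw [nat_card_alternatingGroup]; simp; decide

lemma h2A7 : Nonempty (groupCohomology.H2 (Rep.trivial ℤ (alternatingGroup (Fin 7)) QZ) ≃+ ZMod 6) := by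
  refine final (MonoidHom.id _) Function.injective_id xA yA rA sA rfl rfl rfl rfl ?_
  intro N h1 h2 h3
  have k1 : ((280 : ℕ) : ℤ) ∈ N := index_in (MonoidHom.id _) Function.injective_id xA yA xA yA rfl rfl
    9 280 card9 cardA7 (by norm_num) N h1
  have k2 : ((315 : ℕ) : ℤ) ∈ N := index_in (MonoidHom.id _) Function.injective_id rA sA rA sA rfl rfl
    8 315 card8 cardA7 (by norm_num) N h2
  have k3 : ((504 : ℕ) : ℤ) ∈ N := index_in (MonoidHom.id _) Function.injective_id wA wA wA wA rfl rfl
    5 504 card5 cardA7 (by norm_num) N (h3 _)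
  have k4 : ((360 : ℕ) : ℤ) ∈ N := index_in (MonoidHom.id _) Function.injective_id vA vA vA vA rfl rfl
    7 360 card7 cardA7 (by norm_num) N (h3 _)
  -- 35 = 315 - 280, 10 = 360 - 350, 14 = 504 - 490, 4 = 14 - 10, 3 = 35 - 32, 1 = 4 - 3
  have a35 := N.sub_mem k2 k1
  have a10 := N.sub_mem k4 (N.zsmul_mem a35 10)
  have a14 := N.sub_mem k3 (N.zsmul_mem a35 14)
  have a4 := N.sub_mem a14 a10
  have a3 := N.sub_mem a35 (N.zsmul_mem a4 8)
  have a1 := N.sub_mem a4 a3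
  norm_num at a1
  exact a1

def f67 : Fin 6 ≃ {i : Fin 7 // i.1 < 6} where
  toFun i := ⟨⟨i.1, by omega⟩, i.2⟩
  invFun i := ⟨i.1.1, i.2⟩
  left_inv _ := rfl
  right_inv _ := rfl

def φ67 : alternatingGroup (Fin 6) →* alternatingGroup (Fin 7) :=
  ((Equiv.Perm.extendDomainHom f67).comp (alternatingGroup (Fin 6)).subtype).codRestrict _ (by
    intro g
    change Equiv.Perm.sign (Equiv.Perm.extendDomain g.1 f67) = 1
    rw [Equiv.Perm.sign_extendDomain]
    exact g.2)

lemma φ67_inj : Function.Injective φ67 := by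
  intro a b h
  apply Subtype.ext
  exact Equiv.Perm.extendDomainHom_injective f67 (congrArg Subtype.val h)

def dig6 (n i : ℕ) : Fin 6 := Fin.ofNat 6 (n / 10 ^ (5 - i) % 10)

def dP6 (n m : ℕ) (h : ∀ i : Fin 6, dig6 m (dig6 n i) = i ∧ dig6 n (dig6 m i) = i) :
    Equiv.Perm (Fin 6) where
  toFun i := dig6 n i
  invFun i := dig6 m i
  left_inv i := (h i).1
  right_inv i := (h i).2

def xB : alternatingGroup (Fin 6) := ⟨dP6 120345 201345 (by decide +kernel), by
  change Equiv.Perm.sign _ = 1; decide +kernel⟩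
def yB : alternatingGroup (Fin 6) := ⟨dP6 012453 012534 (by decide +kernel), by
  change Equiv.Perm.sign _ = 1; decide +kernel⟩
def rB : alternatingGroup (Fin 6) := ⟨dP6 231054 320154 (by decide +kernel), by
  change Equiv.Perm.sign _ = 1; decide +kernel⟩
def sB : alternatingGroup (Fin 6) := ⟨dP6 230145 230145 (by decide +kernel), by
  change Equiv.Perm.sign _ = 1; decide +kernel⟩
def wB : alternatingGroup (Fin 6) := ⟨dP6 123405 401235 (by decide +kernel), by
  change Equiv.Perm.sign _ = 1; decide +kernel⟩

lemma xB_eq : φ67 xB = xA := by decide +kernel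
lemma yB_eq : φ67 yB = yA := by decide +kernel
lemma rB_eq : φ67 rB = rA := by decide +kernel
lemma sB_eq : φ67 sB = sA := by decide +kernel
lemma wB_eq : φ67 wB = wA := by decide +kernel

lemma h2A6 : Nonempty (groupCohomology.H2 (Rep.trivial ℤ (alternatingGroup (Fin 6)) QZ) ≃+ ZMod 6) := by
  refine final φ67 φ67_inj xB yB rB sB xB_eq yB_eq rB_eq sB_eq ?_
  intro N h1 h2 h3
  have k1 : ((40 : ℕ) : ℤ) ∈ N := index_in φ67 φ67_inj xB yB xA yA xB_eq yB_eq
    9 40 card9 cardA6 (by norm_num) N h1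
  have k2 : ((45 : ℕ) : ℤ) ∈ N := index_in φ67 φ67_inj rB sB rA sA rB_eq sB_eq
    8 45 card8 cardA6 (by norm_num) N h2
  have k3 : ((72 : ℕ) : ℤ) ∈ N := index_in φ67 φ67_inj wB wB wA wA wB_eq wB_eq
    5 72 card5 cardA6 (by norm_num) N (h3 _)
  -- 5 = 45 - 40, 2 = 72 - 70, 1 = 5 - 4
  have a5 := N.sub_mem k2 k1
  have a2 := N.sub_mem k3 (N.zsmul_mem a5 14)
  have a1 := N.sub_mem a5 (N.zsmul_mem a2 2)
  norm_num at a1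
  exact a1

end Fin5

/-- `H³(𝔄₆, ℤ_triv) ≅ ℤ/6ℤ` and `H³(𝔄₇, ℤ_triv) ≅ ℤ/6ℤ`. -/
theorem stmt_4 :
    Nonempty ((groupCohomology (Rep.trivial ℤ (Alt 6) ℤ) 3) ≃+ ZMod 6) ∧
    Nonempty ((groupCohomology (Rep.trivial ℤ (Alt 7) ℤ) 3) ≃+ ZMod 6) := by
  obtain ⟨a6⟩ := H3equiv (Alt 6)
  obtain ⟨a7⟩ := H3equiv (Alt 7)
  obtain ⟨b6⟩ := h2A6
  obtain ⟨b7⟩ := h2A7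
  exact ⟨⟨a6.trans b6⟩, ⟨a7.trans b7⟩⟩
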